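/- For every real ν ≥ −1/2, the derivative of the normalized Struve function at 1 is positive: h_ν'(1) > 0. -/

import Mathlib

noncomputable section

/-- The normalized Struve function of the first kind (real restriction),
`h_ν(x) = (√π/2) ∑ (−1)^n Γ(ν+3/2) x^(n+1) / (4^n Γ(n+3/2) Γ(ν+n+3/2))`. -/
def struveHR (ν : ℝ) (x : ℝ) : ℝ :=
  Real.sqrt Real.pi / 2 *
    ∑' n : ℕ, ((-1 : ℝ) ^ n * Real.Gamma (ν + 3 / 2) * x ^ (n + 1)) /
      (4 ^ n * Real.Gamma ((n : ℝ) + 3 / 2) * Real.Gamma (ν + n + 3 / 2))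

/-- The absolute value of the `n`-th Taylor coefficient of the Struve series, up to `√π / 2`. -/
def struveCoeff (ν : ℝ) (n : ℕ) : ℝ :=
  Real.Gamma (ν + 3 / 2) / (4 ^ n * Real.Gamma ((n : ℝ) + 3 / 2) * Real.Gamma (ν + n + 3 / 2))

lemma struveHR_eq (ν x : ℝ) :
    struveHR ν x = √Real.pi / 2 * ∑' n : ℕ, (-1 : ℝ) ^ n * struveCoeff ν n * x ^ (n + 1) := by
  unfold struveHR struveCoeff
  congr 1
  exact tsum_congr fun n => by ring

lemma struveCoeff_pos {ν : ℝ} (hν : -(1 / 2) ≤ ν) (n : ℕ) : 0 < struveCoeff ν n := by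
  have hn : (0 : ℝ) ≤ n := n.cast_nonneg
  have h1 := Real.Gamma_pos_of_pos (show 0 < ν + 3 / 2 by linarith)
  have h2 := Real.Gamma_pos_of_pos (show 0 < (n : ℝ) + 3 / 2 by linarith)
  have h3 := Real.Gamma_pos_of_pos (show 0 < ν + n + 3 / 2 by linarith)
  unfold struveCoeff
  positivity

lemma struveCoeff_succ {ν : ℝ} (hν : -(1 / 2) ≤ ν) (n : ℕ) :
    struveCoeff ν n =
      4 * ((n : ℝ) + 3 / 2) * (ν + n + 3 / 2) * struveCoeff ν (n + 1) := by
  have hn : (0 : ℝ) ≤ n := n.cast_nonneg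
  have p2 : 0 < (n : ℝ) + 3 / 2 := by linarith
  have p3 : 0 < ν + n + 3 / 2 := by linarith
  have h2 := Real.Gamma_pos_of_pos p2
  have h3 := Real.Gamma_pos_of_pos p3
  have e2 : ((n + 1 : ℕ) : ℝ) + 3 / 2 = ((n : ℝ) + 3 / 2) + 1 := by push_cast; ring
  have e3 : ν + ((n + 1 : ℕ) : ℝ) + 3 / 2 = (ν + n + 3 / 2) + 1 := by push_cast; ring
  unfold struveCoeff
  rw [e2, e3, Real.Gamma_add_one p2.ne', Real.Gamma_add_one p3.ne', pow_succ]
  generalize Real.Gamma ((n : ℝ) + 3 / 2) = a at *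
  generalize Real.Gamma (ν + n + 3 / 2) = b at *
  generalize (n : ℝ) + 3 / 2 = c at *
  generalize ν + n + 3 / 2 = d at *
  field_simp

/-- The coefficients of the derivative of the Struve series decay at least like `3⁻ⁿ`. -/
lemma succ_mul_struveCoeff_le {ν : ℝ} (hν : -(1 / 2) ≤ ν) (n : ℕ) :
    ((n : ℝ) + 1) * struveCoeff ν n ≤ struveCoeff ν 0 * (1 / 3) ^ n := by
  induction n with
  | zero => simp
  | succ n ih =>
    have hn : (0 : ℝ) ≤ n := n.cast_nonneg
    have hc := struveCoeff_pos hν (n + 1)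
    rw [struveCoeff_succ hν n] at ih
    have hd : ((n : ℝ) + 1) ≤ ν + n + 3 / 2 := by linarith
    have hk : 3 * ((n : ℝ) + 2) ≤
        (n + 1) * (4 * ((n : ℝ) + 3 / 2) * (ν + n + 3 / 2)) := by
      calc 3 * ((n : ℝ) + 2) ≤ (n + 1) * (4 * ((n : ℝ) + 3 / 2) * (n + 1)) := by
            nlinarith [mul_nonneg hn hn, mul_nonneg hn (mul_nonneg hn hn)]
        _ ≤ _ := by gcongr
    have := mul_le_mul_of_nonneg_right hk hc.le
    rw [pow_succ]
    push_cast
    linarith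

lemma hasDerivAt_struveHR_one {ν : ℝ} (hν : -(1 / 2) ≤ ν) :
    HasDerivAt (struveHR ν)
      (√Real.pi / 2 * ∑' n : ℕ, (-1 : ℝ) ^ n * (((n : ℝ) + 1) * struveCoeff ν n)) 1 := by
  have hu : Summable fun n : ℕ => struveCoeff ν 0 * (2 / 3 : ℝ) ^ n :=
    (summable_geometric_of_lt_one (by norm_num) (by norm_num)).mul_left _
  have key := hasDerivAt_tsum_of_isPreconnected hu Metric.isOpen_ball
    (convex_ball (0 : ℝ) 2).isPreconnected
    (g := fun n x => (-1 : ℝ) ^ n * struveCoeff ν n * x ^ (n + 1))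
    (g' := fun n x => (-1 : ℝ) ^ n * struveCoeff ν n * (((n : ℝ) + 1) * x ^ n))
    (y₀ := 0) (y := 1)
    (fun n x _ => by
      simpa using (hasDerivAt_pow (n + 1) x).const_mul ((-1 : ℝ) ^ n * struveCoeff ν n))
    (fun n x hx => by
      have hc := struveCoeff_pos hν n
      have hx' : |x| ≤ 2 := by simpa using (mem_ball_zero_iff.mp hx).le
      have hn : (0 : ℝ) < (n : ℝ) + 1 := by positivity
      calc ‖(-1 : ℝ) ^ n * struveCoeff ν n * (((n : ℝ) + 1) * x ^ n)‖
          = ((n : ℝ) + 1) * struveCoeff ν n * |x| ^ n := by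
            simp only [Real.norm_eq_abs, abs_mul, abs_pow, abs_neg, abs_one, one_pow,
              abs_of_pos hc, abs_of_pos hn]
            ring
        _ ≤ struveCoeff ν 0 * (1 / 3) ^ n * 2 ^ n := by
            have := succ_mul_struveCoeff_le hν n
            have h0 := struveCoeff_pos hν 0
            gcongr
        _ = struveCoeff ν 0 * (2 / 3) ^ n := by
            rw [mul_assoc, ← mul_pow]
            norm_num)
    (by simp) (by simp) (by simp)
  rw [funext (struveHR_eq ν), tsum_congr fun n : ℕ => show
    (-1 : ℝ) ^ n * (((n : ℝ) + 1) * struveCoeff ν n) =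
      (-1 : ℝ) ^ n * struveCoeff ν n * (((n : ℝ) + 1) * 1 ^ n) by ring]
  exact key.const_mul (√Real.pi / 2)

/-- For every `ν ≥ -1/2`, `h_ν'(1) > 0`. -/
theorem struveH_deriv_one_pos (ν : ℝ) (hν : -(1 / 2) ≤ ν) :
    0 < deriv (struveHR ν) 1 := by
  rw [(hasDerivAt_struveHR_one hν).deriv]
  have hc := struveCoeff_pos hν 0
  have hbound (n : ℕ) : ‖(-1 : ℝ) ^ n * (((n : ℝ) + 1) * struveCoeff ν n)‖ ≤
      struveCoeff ν 0 * (1 / 3) ^ n := by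
    have := struveCoeff_pos hν n
    rw [norm_mul, norm_pow, norm_neg, norm_one, one_pow, one_mul,
      Real.norm_of_nonneg (by positivity)]
    exact succ_mul_struveCoeff_le hν n
  have hg : HasSum (fun n : ℕ => struveCoeff ν 0 * (1 / 3 : ℝ) ^ n) _ :=
    (hasSum_geometric_of_lt_one (by norm_num) (by norm_num)).mul_left _
  have htail := tsum_of_norm_bounded ((hasSum_nat_add_iff' 1).mpr hg) fun n => hbound (n + 1)
  rw [(Summable.of_norm_bounded hg.summable hbound).tsum_eq_zero_add]
  refine mul_pos (by positivity) ?_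
  have hneg := (abs_le.mp htail).1
  norm_num at hneg ⊢
  linarith
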